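/- (Multipartite key step.) For m parties with local dimensions n : Fin m → ℕ, let ψ and φ be the fully product vectors determined by families ψᵢ, φᵢ : Fin (n i) → ℂ of nonzero local vectors (ψ x = Π i, ψᵢ i (x i) and φ x = Π i, φᵢ i (x i)). Suppose there are two distinct indices i₁ ≠ i₂ such that ψᵢ₁ and φᵢ₁ are linearly independent, and ψᵢ₂ and φᵢ₂ are linearly independent. If ρ = a₀₀|ψ⟩⟨ψ| + a₀₁|ψ⟩⟨φ| + a₁₀|φ⟩⟨ψ| + a₁₁|φ⟩⟨φ| is a density matrix with a₁₀ ≠ 0, then ρ is not fully separable. -/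

import Mathlib

open scoped BigOperators ComplexOrder

/-- The outer product |u⟩⟨v|, with entries u x * conj (v y). -/
noncomputable def outer {n : Type*} [Fintype n] (u v : n → ℂ) : Matrix n n ℂ :=
  Matrix.of fun x y => u x * (starRingEnd ℂ) (v y)

/-- The fully product vector determined by local vectors aᵢ : Fin (n i) → ℂ. -/
noncomputable def prodVec {m : ℕ} {n : Fin m → ℕ} (a : ∀ i, Fin (n i) → ℂ) :
    (∀ i, Fin (n i)) → ℂ :=
  fun x => ∏ i, a i (x i)

/-- A fully product vector in the m-partite state space. -/
def IsFullyProdVec {m : ℕ} {n : Fin m → ℕ} (v : (∀ i, Fin (n i)) → ℂ) : Prop :=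
  ∃ a : ∀ i, Fin (n i) → ℂ, v = prodVec a

/-- A state is fully separable if it is a finite sum of outer products of
fully product vectors. -/
noncomputable def FullySeparable {m : ℕ} {n : Fin m → ℕ}
    (ρ : Matrix (∀ i, Fin (n i)) (∀ i, Fin (n i)) ℂ) : Prop :=
  ∃ (N : ℕ) (w : Fin N → ((∀ i, Fin (n i)) → ℂ)),
    (∀ j, IsFullyProdVec (w j)) ∧ ρ = ∑ j, outer (w j) (w j)

open Matrix in
/-- Sandwiching an outer product between two vectors factors into two pairings. -/
lemma dotProduct_outer_mulVec_star {ι : Type*} [Fintype ι] (f g u v : ι → ℂ) :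
    f ⬝ᵥ (outer u v *ᵥ star g) = (f ⬝ᵥ u) * starRingEnd ℂ (g ⬝ᵥ v) := by
  have houter : outer u v = vecMulVec u (star v) := rfl
  rw [houter, vecMulVec_mulVec, dotProduct_smul, op_smul_eq_mul,
    starRingEnd_apply, star_dotProduct_star]

open Matrix in
/-- The bilinear pairing of two product vectors is the product of the local pairings. -/
lemma prodVec_dotProduct_prodVec {m : ℕ} {n : Fin m → ℕ} (f a : ∀ i, Fin (n i) → ℂ) :
    prodVec f ⬝ᵥ prodVec a = ∏ i, f i ⬝ᵥ a i := by
  simp only [dotProduct, prodVec, Finset.prod_univ_sum, Fintype.piFinset_univ,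
    Finset.prod_mul_distrib]

/-- Exchanging one factor between two finite products preserves their product. -/
lemma prod_update_mul_prod_update {ι : Type*} {β : ι → Type*} {M : Type*} [Fintype ι]
    [DecidableEq ι] [CommMonoid M] (F H : ∀ i, β i) (c : ∀ i, β i → M) (k : ι) :
    (∏ i, c i (Function.update F k (H k) i)) * ∏ i, c i (Function.update H k (F k) i) =
      (∏ i, c i (F i)) * ∏ i, c i (H i) := by
  simp only [← Finset.prod_mul_distrib]
  refine Finset.prod_congr rfl fun i _ => ?_
  obtain rfl | h := eq_or_ne i k
  · simp [mul_comm]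
  · simp [h]

open Matrix in
/-- A vector outside the span of another one is detected by a vector annihilating the latter. -/
lemma exists_dotProduct_ne_zero_of_notMem_span {K : Type*} [Field K] {ι : Type*} [Fintype ι]
    {v w : ι → K} (h : v ∉ Submodule.span K {w}) :
    ∃ f : ι → K, f ⬝ᵥ v ≠ 0 ∧ f ⬝ᵥ w = 0 := by
  classical
  obtain ⟨g, hgv, hg⟩ := Submodule.exists_le_ker_of_notMem h
  obtain ⟨f, rfl⟩ := (dotProductEquiv K ι).surjective g
  refine ⟨f, hgv, ?_⟩
  exact hg (Submodule.mem_span_singleton_self w)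

open Matrix in
/-- A family of local vectors pairing nontrivially with every `a i`, and annihilating `b i`
wherever `a i` and `b i` are linearly independent. -/
lemma exists_local_dotProduct_ne_zero {K : Type*} [Field K] {ι : Type*} {κ : ι → Type*}
    [∀ i, Fintype (κ i)] (a b : ∀ i, κ i → K) (ha : ∀ i, a i ≠ 0) :
    ∃ f : ∀ i, κ i → K, (∀ i, f i ⬝ᵥ a i ≠ 0) ∧
      ∀ i, LinearIndependent K ![a i, b i] → f i ⬝ᵥ b i = 0 := by
  have h (i : ι) : ∃ f : κ i → K, f ⬝ᵥ a i ≠ 0 ∧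
      (LinearIndependent K ![a i, b i] → f ⬝ᵥ b i = 0) := by
    by_cases hi : LinearIndependent K ![a i, b i]
    · obtain ⟨f, hfa, hfb⟩ := exists_dotProduct_ne_zero_of_notMem_span
        (v := a i) (w := b i) fun hmem => by
          obtain ⟨c, hc⟩ := Submodule.mem_span_singleton.mp hmem
          have := LinearIndependent.pair_iff.mp hi 1 (-c) (by simp [hc])
          exact one_ne_zero this.1
      exact ⟨f, hfa, fun _ => hfb⟩
    · obtain ⟨f, hfa, -⟩ := exists_dotProduct_ne_zero_of_notMem_span
        (v := a i) (w := 0) (by simpa using ha i)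
      exact ⟨f, hfa, fun h => absurd h hi⟩
  choose f hf using h
  exact ⟨f, fun i => (hf i).1, fun i => (hf i).2⟩

open Matrix in
theorem multipartite_offdiagonal_implies_not_fully_separable
    {m : ℕ} {n : Fin m → ℕ}
    (ψloc φloc : ∀ i, Fin (n i) → ℂ)
    (hψloc : ∀ i, ψloc i ≠ 0) (hφloc : ∀ i, φloc i ≠ 0)
    (i₁ i₂ : Fin m) (hne : i₁ ≠ i₂)
    (h₁ : LinearIndependent ℂ ![ψloc i₁, φloc i₁])
    (h₂ : LinearIndependent ℂ ![ψloc i₂, φloc i₂])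
    (a00 a01 a10 a11 : ℂ)
    (ρ : Matrix (∀ i, Fin (n i)) (∀ i, Fin (n i)) ℂ)
    (hdef : ρ = a00 • outer (prodVec ψloc) (prodVec ψloc)
      + a01 • outer (prodVec ψloc) (prodVec φloc)
      + a10 • outer (prodVec φloc) (prodVec ψloc)
      + a11 • outer (prodVec φloc) (prodVec φloc))
    (hρ : ρ.PosSemidef) (htr : ρ.trace = 1)
    (h10 : a10 ≠ 0) :
    ¬ FullySeparable ρ := by
  classical
  rintro ⟨N, w, hw, hsum⟩
  choose a ha using hw
  obtain ⟨F, hF, hF0⟩ := exists_local_dotProduct_ne_zero ψloc φloc hψloc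
  obtain ⟨H, hH, hH0⟩ := exists_local_dotProduct_ne_zero φloc ψloc hφloc
  have hψF : prodVec F ⬝ᵥ prodVec ψloc ≠ 0 := by
    rw [prodVec_dotProduct_prodVec]
    exact Finset.prod_ne_zero_iff.mpr fun i _ => hF i
  have hφF : prodVec F ⬝ᵥ prodVec φloc = 0 := by
    rw [prodVec_dotProduct_prodVec]
    exact Finset.prod_eq_zero (Finset.mem_univ i₁) (hF0 i₁ h₁)
  have hφH : prodVec H ⬝ᵥ prodVec φloc ≠ 0 := by
    rw [prodVec_dotProduct_prodVec]
    exact Finset.prod_ne_zero_iff.mpr fun i _ => hH i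
  have hψH : prodVec H ⬝ᵥ prodVec ψloc = 0 := by
    rw [prodVec_dotProduct_prodVec]
    exact Finset.prod_eq_zero (Finset.mem_univ i₂) (hH0 i₂ (LinearIndependent.pair_symm_iff.mp h₂))
  set G := Function.update F i₂ (H i₂) with hG
  have hψG : prodVec G ⬝ᵥ prodVec ψloc = 0 := by
    rw [prodVec_dotProduct_prodVec]
    refine Finset.prod_eq_zero (Finset.mem_univ i₂) ?_
    rw [hG, Function.update_self]
    exact hH0 i₂ (LinearIndependent.pair_symm_iff.mp h₂)
  have hφG : prodVec G ⬝ᵥ prodVec φloc = 0 := by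
    rw [prodVec_dotProduct_prodVec]
    refine Finset.prod_eq_zero (Finset.mem_univ i₁) ?_
    rw [hG, Function.update_of_ne hne]
    exact hF0 i₁ h₁
  have hform (f g : (∀ i, Fin (n i)) → ℂ) : f ⬝ᵥ (ρ *ᵥ star g) =
      ∑ j, (f ⬝ᵥ w j) * starRingEnd ℂ (g ⬝ᵥ w j) := by
    simp only [hsum, sum_mulVec, dotProduct_sum, dotProduct_outer_mulVec_star]
  have hGw (j : Fin N) : prodVec G ⬝ᵥ w j = 0 := by
    have hzero : prodVec G ⬝ᵥ (ρ *ᵥ star (prodVec G)) = 0 := by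
      simp [hdef, add_mulVec, smul_mulVec, dotProduct_outer_mulVec_star, hψG, hφG]
    rw [hform] at hzero
    simp only [Complex.mul_conj] at hzero
    norm_cast at hzero
    exact Complex.normSq_eq_zero.mp <|
      (Finset.sum_eq_zero_iff_of_nonneg fun j _ => Complex.normSq_nonneg _).mp hzero j
        (Finset.mem_univ j)
  have hFHw (j : Fin N) : prodVec F ⬝ᵥ w j = 0 ∨ prodVec H ⬝ᵥ w j = 0 := by
    have hswap := prod_update_mul_prod_update F H (fun i f => f ⬝ᵥ a j i) i₂
    have hj := hGw j
    rw [ha j, prodVec_dotProduct_prodVec] at hj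
    rw [← mul_eq_zero, ha j, prodVec_dotProduct_prodVec, prodVec_dotProduct_prodVec, ← hswap,
      ← hG, hj, zero_mul]
  have hoff : prodVec H ⬝ᵥ (ρ *ᵥ star (prodVec F)) = 0 := by
    rw [hform]
    refine Finset.sum_eq_zero fun j _ => ?_
    rcases hFHw j with h | h <;> simp [h]
  simp [hdef, add_mulVec, smul_mulVec, dotProduct_outer_mulVec_star, hφF, hψH, h10, hψF, hφH]
    at hoff
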